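/- Suppose a < 0 and a + b = 0. Then there exists an a.s. finite random variable L whose distribution is Gaussian such that, almost surely, lim_{t→∞} (X(t) − U(t)) = L and lim_{t→∞} (1/(1+t)) ( ∫_{−1}^0 ψ(u) du + ∫_0^t X(s) ds ) = L. -/

import Mathlib

open MeasureTheory ProbabilityTheory Filter Real Set

noncomputable section

/-- `B` is a standard one-dimensional Brownian motion adapted to the filtration `F`
under the probability measure `P`: all paths are continuous and start at `0`, the
increment `B t - B s` is Gaussian with mean `0` and variance `t - s`, and increments
after time `s` are independent of `F s`. -/
def IsStdBrownian {Ω : Type*} {mΩ : MeasurableSpace Ω} (P : Measure Ω)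
    (F : MeasureTheory.Filtration ℝ mΩ) (B : ℝ → Ω → ℝ) : Prop :=
  MeasureTheory.Adapted F B ∧
  (∀ ω, B 0 ω = 0) ∧
  (∀ ω, Continuous fun t => B t ω) ∧
  (∀ s t : ℝ, 0 ≤ s → s ≤ t →
    P.map (fun ω => B t ω - B s ω) = gaussianReal 0 (Real.toNNReal (t - s))) ∧
  (∀ s t : ℝ, 0 ≤ s → s ≤ t →
    Indep (MeasurableSpace.comap (fun ω => B t ω - B s ω) Real.measurableSpace) (F s) P)

/-- `X` is the (continuous, adapted) solution of the affine stochastic functional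
differential equation `dX(t) = (a X(t) + b/(1+t) ∫_{-1}^t X(s) ds) dt + σ dB(t)` for
`t ≥ 0`, with initial history `ψ` on `[-1, 0]`; i.e. almost surely, for all `t ≥ 0`,
`X t = ψ 0 + ∫_0^t (a X(s) + b/(1+s) (∫_{-1}^0 ψ(u) du + ∫_0^s X(u) du)) ds + σ B t`. -/
def IsSolutionSFDE {Ω : Type*} {mΩ : MeasurableSpace Ω} (P : Measure Ω)
    (F : MeasureTheory.Filtration ℝ mΩ) (a b σ : ℝ) (ψ : ℝ → ℝ)
    (B X : ℝ → Ω → ℝ) : Prop :=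
  (∀ t : ℝ, 0 ≤ t → StronglyMeasurable[F t] (X t)) ∧
  (∀ ω, ContinuousOn (fun t => X t ω) (Set.Ici (0 : ℝ))) ∧
  (∀ᵐ ω ∂P, ∀ t : ℝ, 0 ≤ t →
    X t ω = ψ 0
      + (∫ s in (0:ℝ)..t,
          (a * X s ω + b / (1 + s) * ((∫ u in (-1:ℝ)..(0:ℝ), ψ u) + ∫ u in (0:ℝ)..s, X u ω)))
      + σ * B t ω)

/-- `U` is the Ornstein–Uhlenbeck process driven by `σ B` with `U 0 = 0`: the
(continuous, adapted) process with, almost surely, `U t = a ∫_0^t U(s) ds + σ B t`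
for all `t ≥ 0`. -/
def IsOUProcess {Ω : Type*} {mΩ : MeasurableSpace Ω} (P : Measure Ω)
    (F : MeasureTheory.Filtration ℝ mΩ) (a σ : ℝ) (B U : ℝ → Ω → ℝ) : Prop :=
  (∀ t : ℝ, 0 ≤ t → StronglyMeasurable[F t] (U t)) ∧
  (∀ ω, ContinuousOn (fun t => U t ω) (Set.Ici (0 : ℝ))) ∧
  (∀ᵐ ω ∂P, ∀ t : ℝ, 0 ≤ t →
    U t ω = a * (∫ s in (0:ℝ)..t, U s ω) + σ * B t ω)

theorem tendsto_riemannSum {f : ℝ → ℝ} {T : ℝ} (hT : 0 ≤ T) (hf : ContinuousOn f (Icc 0 T)) :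
    Tendsto (fun n : ℕ => ∑ i ∈ Finset.range (n + 1), (T / (n + 1)) * f (i * (T / (n + 1))))
      atTop (nhds (∫ s in (0:ℝ)..T, f s)) := by
  rw [Metric.tendsto_atTop]
  intro ε hε
  have huc := isCompact_Icc.uniformContinuousOn_of_continuous hf
  rw [Metric.uniformContinuousOn_iff] at huc
  obtain ⟨δ, hδ, hδf⟩ := huc (ε / (T + 1)) (by positivity)
  obtain ⟨N, hN⟩ := exists_nat_gt (T / δ)
  refine ⟨N, fun n hn => ?_⟩
  have hn0 : (0:ℝ) < n + 1 := by positivity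
  set h : ℝ := T / (n + 1) with hh
  have hh0 : 0 ≤ h := by positivity
  have hnh : (n + 1) * h = T := by rw [hh]; field_simp
  have hhδ : h < δ := by
    rw [hh, div_lt_iff₀ hn0]
    rw [div_lt_iff₀ hδ] at hN
    have : (N : ℝ) ≤ n := by exact_mod_cast hn
    nlinarith
  have hmem : ∀ i < n + 1, ∀ x ∈ Icc ((i : ℝ) * h) (((i + 1 : ℕ) : ℝ) * h), x ∈ Icc 0 T := by
    intro i hi x hx
    have h1 : ((i + 1 : ℕ) : ℝ) ≤ n + 1 := by exact_mod_cast hi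
    refine ⟨le_trans (by positivity) hx.1, hx.2.trans ?_⟩
    rw [← hnh]
    gcongr
  have hle : ∀ i : ℕ, (i : ℝ) * h ≤ ((i + 1 : ℕ) : ℝ) * h := fun i => by
    gcongr; simp
  have hint : ∀ i < n + 1,
      IntervalIntegrable f volume ((i : ℝ) * h) (((i + 1 : ℕ) : ℝ) * h) := by
    intro i hi
    apply ContinuousOn.intervalIntegrable
    rw [uIcc_of_le (hle i)]
    exact hf.mono (hmem i hi)
  have hsum := intervalIntegral.sum_integral_adjacent_intervals
    (a := fun i : ℕ => (i : ℝ) * h) (n := n + 1) (f := f) (μ := volume) hint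
  have hT' : ((n + 1 : ℕ) : ℝ) * h = T := by push_cast; exact hnh
  simp only [hT', Nat.cast_zero, zero_mul] at hsum
  rw [← hsum, Real.dist_eq, ← Finset.sum_sub_distrib]
  have hterm : ∀ i ∈ Finset.range (n + 1),
      |h * f (i * h) - ∫ x in ((i : ℝ) * h)..(((i + 1 : ℕ) : ℝ) * h), f x| ≤ ε / (T + 1) * h := by
    intro i hi
    have hi := Finset.mem_range.1 hi
    have hconst : h * f (i * h) = ∫ x in ((i : ℝ) * h)..(((i + 1 : ℕ) : ℝ) * h), f (i * h) := by
      simp; ring_nf; simp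
    rw [hconst, ← intervalIntegral.integral_sub (by simp) (hint i hi), ← Real.norm_eq_abs]
    refine (intervalIntegral.norm_integral_le_of_norm_le_const (C := ε / (T + 1)) ?_).trans ?_
    · intro x hx
      rw [uIoc_of_le (hle i)] at hx
      have hx' : x ∈ Icc ((i : ℝ) * h) (((i + 1 : ℕ) : ℝ) * h) := ⟨hx.1.le, hx.2⟩
      have := hδf _ (hmem i hi _ (left_mem_Icc.2 (hle i))) _ (hmem i hi x hx') (by
        rw [Real.dist_eq, abs_sub_comm, abs_of_nonneg (sub_nonneg.2 hx.1.le)]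
        have := hx.2
        push_cast at this
        nlinarith)
      exact this.le
    · rw [abs_of_nonneg (sub_nonneg.2 (hle i))]
      apply le_of_eq
      push_cast
      ring
  calc _ ≤ ∑ i ∈ Finset.range (n + 1), ε / (T + 1) * h :=
        (Finset.abs_sum_le_sum_abs _ _).trans (Finset.sum_le_sum hterm)
    _ = ε / (T + 1) * T := by simp [← hnh]; ring
    _ < ε := by
        rw [div_mul_eq_mul_div, div_lt_iff₀ (by positivity)]
        nlinarith

section GaussianClosure

variable {Ω : Type*} {mΩ : MeasurableSpace Ω}

/-- The real random variable `Y` has a (possibly degenerate) centered Gaussian law. -/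
def HasCenteredGaussianLaw (P : Measure Ω) (Y : Ω → ℝ) : Prop :=
  ∃ v : NNReal, P.map Y = gaussianReal 0 v

theorem HasCenteredGaussianLaw.aemeasurable {P : Measure Ω} {Y : Ω → ℝ}
    (h : HasCenteredGaussianLaw P Y) : AEMeasurable Y P := by
  obtain ⟨v, hv⟩ := h
  apply AEMeasurable.of_map_ne_zero
  simp [NeZero.ne, hv]

theorem HasCenteredGaussianLaw.of_tendsto {P : Measure Ω} [IsProbabilityMeasure P]
    {Y : ℕ → Ω → ℝ} {Z : Ω → ℝ} (hY : ∀ n, HasCenteredGaussianLaw P (Y n))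
    (hlim : ∀ᵐ ω ∂P, Tendsto (fun n => Y n ω) atTop (nhds (Z ω))) :
    HasCenteredGaussianLaw P Z := by
  have hm : ∀ n, AEMeasurable (Y n) P := fun n => (hY n).aemeasurable
  have hZm : AEMeasurable Z P := aemeasurable_of_tendsto_metrizable_ae atTop hm hlim
  have : IsProbabilityMeasure (P.map Z) := Measure.isProbabilityMeasure_map hZm
  have hφ : ∀ t : ℝ, Tendsto (fun n => charFun (P.map (Y n)) t) atTop
      (nhds (charFun (P.map Z) t)) := by
    intro t
    simp_rw [charFun_apply_real]
    rw [integral_map hZm (by fun_prop)]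
    have : ∀ n, ∫ x, Complex.exp (t * x * Complex.I) ∂(P.map (Y n))
        = ∫ ω, Complex.exp (t * (Y n ω) * Complex.I) ∂P := fun n => by
      rw [integral_map (hm n) (by fun_prop)]
    simp_rw [this]
    refine tendsto_integral_of_dominated_convergence (fun _ => 1) ?_ (by simp) ?_ ?_
    · intro n
      have := hm n
      exact Measurable.comp_aemeasurable (g := fun x : ℝ => Complex.exp (t * x * Complex.I))
        (by fun_prop) (hm n) |>.aestronglyMeasurable
    · intro n
      filter_upwards with ω
      rw [← Complex.ofReal_mul, Complex.norm_exp_ofReal_mul_I]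
    · filter_upwards [hlim] with ω hω
      have hc : Continuous fun x : ℝ => Complex.exp (t * x * Complex.I) := by fun_prop
      exact (hc.tendsto _).comp hω
  choose v hv using hY
  have hφv : ∀ n t, charFun (P.map (Y n)) t = Real.exp (-(v n * t ^ 2 / 2)) := by
    intro n t
    rw [hv, charFun_gaussianReal]
    push_cast
    simp
  obtain ⟨t₀, ht₀, hne⟩ : ∃ t₀ : ℝ, t₀ ≠ 0 ∧ charFun (P.map Z) t₀ ≠ 0 := by
    have h0 : charFun (P.map Z) 0 ≠ 0 := by simp
    have hc : ContinuousAt (charFun (P.map Z)) 0 := by fun_prop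
    have := hc.eventually_ne h0
    have h2 : ∀ᶠ t in nhdsWithin (0:ℝ) {0}ᶜ, charFun (P.map Z) t ≠ 0 :=
      this.filter_mono nhdsWithin_le_nhds
    obtain ⟨t, h1, h2⟩ := (h2.and self_mem_nhdsWithin).exists
    exact ⟨t, h2, h1⟩
  have hvlim : Tendsto (fun n => (v n : ℝ)) atTop
      (nhds (-(2 / t₀ ^ 2) * Real.log ‖charFun (P.map Z) t₀‖)) := by
    have h1 := ((hφ t₀).norm.log (norm_ne_zero_iff.2 hne)).const_mul (-(2 / t₀ ^ 2))
    refine h1.congr fun n => ?_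
    rw [hφv, Complex.norm_real, Real.norm_eq_abs, Real.abs_exp, Real.log_exp]
    field_simp
  obtain ⟨w, hw⟩ : ∃ w : NNReal, Tendsto (fun n => (v n : ℝ)) atTop (nhds (w : ℝ)) :=
    ⟨⟨_, ge_of_tendsto' hvlim fun n => (v n).2⟩, hvlim⟩
  refine ⟨w, Measure.ext_of_charFun ?_⟩
  ext t
  refine tendsto_nhds_unique (hφ t) ?_
  have h2 : charFun (gaussianReal 0 w) t = (Real.exp (-(w * t ^ 2 / 2)) : ℝ) := by
    rw [charFun_gaussianReal]
    push_cast
    simp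
  rw [h2]
  simp_rw [hφv]
  have hc : Continuous fun x : ℝ => ((Real.exp (-(x * t ^ 2 / 2)) : ℝ) : ℂ) := by fun_prop
  exact (hc.tendsto _).comp hw

/-- The smallest class of functions containing `S` and closed under a.e. limits of sequences. -/
inductive SeqAEClosure (P : Measure Ω) (S : Submodule ℝ (Ω → ℝ)) : (Ω → ℝ) → Prop
  | of_mem {Y : Ω → ℝ} (h : Y ∈ S) : SeqAEClosure P S Y
  | of_tendsto {Y : ℕ → Ω → ℝ} {Z : Ω → ℝ} (h : ∀ n, SeqAEClosure P S (Y n))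
      (hlim : ∀ᵐ ω ∂P, Tendsto (fun n => Y n ω) atTop (nhds (Z ω))) : SeqAEClosure P S Z

namespace SeqAEClosure

variable {P : Measure Ω} {S : Submodule ℝ (Ω → ℝ)}

theorem hasCenteredGaussianLaw [IsProbabilityMeasure P]
    (hS : ∀ Y ∈ S, HasCenteredGaussianLaw P Y) {Y : Ω → ℝ} (hY : SeqAEClosure P S Y) :
    HasCenteredGaussianLaw P Y := by
  induction hY with
  | of_mem h => exact hS _ h
  | of_tendsto _ hlim ih => exact .of_tendsto ih hlim

theorem const_mul {Y : Ω → ℝ} (hY : SeqAEClosure P S Y) (c : ℝ) :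
    SeqAEClosure P S (fun ω => c * Y ω) := by
  induction hY with
  | of_mem h => exact of_mem (S.smul_mem c h)
  | of_tendsto _ hlim ih =>
    exact of_tendsto ih (hlim.mono fun ω hω => hω.const_mul c)

theorem add {Y Z : Ω → ℝ} (hY : SeqAEClosure P S Y) (hZ : SeqAEClosure P S Z) :
    SeqAEClosure P S (fun ω => Y ω + Z ω) := by
  induction hZ with
  | of_mem hZ =>
    induction hY with
    | of_mem hY => exact of_mem (S.add_mem hY hZ)
    | of_tendsto _ hlim ih =>
      exact of_tendsto ih (hlim.mono fun ω hω => hω.add_const _)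
  | of_tendsto _ hlim ih =>
    exact of_tendsto ih (hlim.mono fun ω hω => hω.const_add _)

theorem sum {ι : Type*} (s : Finset ι) {Y : ι → Ω → ℝ} (hY : ∀ i ∈ s, SeqAEClosure P S (Y i)) :
    SeqAEClosure P S (fun ω => ∑ i ∈ s, Y i ω) := by
  classical
  induction s using Finset.induction_on with
  | empty => exact of_mem S.zero_mem
  | insert a s ha ih =>
    simp_rw [Finset.sum_insert ha]
    exact (hY a (by simp)).add (ih fun i hi => hY i (by simp [hi]))

theorem intervalIntegral {Y : ℝ → Ω → ℝ} {T : ℝ} (hT : 0 ≤ T)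
    (hc : ∀ ω, ContinuousOn (fun t => Y t ω) (Icc 0 T))
    (hY : ∀ t, 0 ≤ t → SeqAEClosure P S (Y t)) :
    SeqAEClosure P S (fun ω => ∫ s in (0:ℝ)..T, Y s ω) := by
  refine of_tendsto (Y := fun n ω => ∑ i ∈ Finset.range (n + 1),
    (T / (n + 1)) * Y (i * (T / (n + 1))) ω) (fun n => ?_)
    (Eventually.of_forall fun ω => tendsto_riemannSum hT (hc ω))
  exact sum _ fun i _ => (hY _ (by positivity)).const_mul _

end SeqAEClosure

namespace IsStdBrownian

variable {P : Measure Ω} {F : MeasureTheory.Filtration ℝ mΩ} {B : ℝ → Ω → ℝ}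

theorem measurable (hB : IsStdBrownian P F B) (t : ℝ) : Measurable (B t) :=
  (hB.1 t).mono (F.le t) le_rfl

theorem map_eq (hB : IsStdBrownian P F B) {t : ℝ} (ht : 0 ≤ t) :
    P.map (B t) = gaussianReal 0 t.toNNReal := by
  have := hB.2.2.2.1 0 t le_rfl ht
  simpa [hB.2.1] using this

theorem hasCenteredGaussianLaw_sum (hB : IsStdBrownian P F B) [IsProbabilityMeasure P]
    (s : Finset NNReal) (c : NNReal → ℝ) :
    HasCenteredGaussianLaw P (fun ω => ∑ t ∈ s, c t * B t ω) := by
  induction s using Finset.induction_on_max generalizing c with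
  | empty => exact ⟨0, by simp [gaussianReal_zero_var]⟩
  | insert a s hmax ih =>
    have ha : a ∉ s := fun h => lt_irrefl _ (hmax a h)
    obtain ⟨m, hma, hsm, c', hc'⟩ : ∃ m ≤ a, (∀ t ∈ s, t ≤ m) ∧ ∃ c' : NNReal → ℝ,
        ∀ ω, ∑ t ∈ insert a s, c t * B t ω
          = (∑ t ∈ s, c' t * B t ω) + c a * (B a ω - B m ω) := by
      rcases s.eq_empty_or_nonempty with rfl | hs
      · exact ⟨0, zero_le, by simp, c, fun ω => by simp [hB.2.1]⟩
      · refine ⟨s.max' hs, (hmax _ (s.max'_mem hs)).le, fun t ht => s.le_max' t ht,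
          fun t => c t + if t = s.max' hs then c a else 0, fun ω => ?_⟩
        simp [Finset.sum_insert ha, add_mul, Finset.sum_add_distrib, ite_mul, s.max'_mem hs]
        ring
    obtain ⟨v, hv⟩ := ih c'
    have hincr := hB.2.2.2.1 m a m.2 (by exact_mod_cast hma)
    have hmeas : Measurable fun ω => B a ω - B m ω := (hB.measurable a).sub (hB.measurable m)
    have hincr' : P.map (fun ω => c a * (B a ω - B m ω))
        = gaussianReal 0 (⟨c a ^ 2, sq_nonneg _⟩ * Real.toNNReal (a - m)) := by
      have h := gaussianReal_map_const_mul (μ := 0) (v := Real.toNNReal (a - m)) (c a)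
      rw [← hincr, Measure.map_map (by fun_prop) hmeas, mul_zero] at h
      exact h
    have hpast : Measurable[F m] fun ω => ∑ t ∈ s, c' t * B t ω := by
      refine Finset.measurable_fun_sum s fun t ht => Measurable.const_mul ?_ _
      exact (hB.1 t).mono (F.mono (by exact_mod_cast hsm t ht)) le_rfl
    have hind : IndepFun (fun ω => ∑ t ∈ s, c' t * B t ω)
        (fun ω => c a * (B a ω - B m ω)) P := by
      have h1 : IndepFun (fun ω => B a ω - B m ω) (fun ω => ∑ t ∈ s, c' t * B t ω) P := by
        rw [IndepFun_iff_Indep]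
        exact indep_of_indep_of_le_right (hB.2.2.2.2 m a m.2 (by exact_mod_cast hma))
          hpast.comap_le
      exact (h1.comp (φ := fun x => c a * x) (ψ := id) (by fun_prop) measurable_id).symm
    have hadd := gaussianReal_add_gaussianReal_of_indepFun hind hv hincr'
    refine ⟨v + ⟨c a ^ 2, sq_nonneg _⟩ * Real.toNNReal (a - m), ?_⟩
    rw [add_zero] at hadd
    rw [← hadd]
    congr 1
    ext ω
    exact hc' ω

theorem hasCenteredGaussianLaw_of_mem_span (hB : IsStdBrownian P F B) [IsProbabilityMeasure P]
    {Y : Ω → ℝ} (hY : Y ∈ Submodule.span ℝ (range fun t : NNReal => B t)) :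
    HasCenteredGaussianLaw P Y := by
  obtain ⟨c, rfl⟩ := Finsupp.mem_span_range_iff_exists_finsupp.1 hY
  have h : (c.sum fun i a => a • B i) = fun ω => ∑ t ∈ c.support, c t * B t ω := by
    ext ω
    simp [Finsupp.sum]
  rw [h]
  exact hB.hasCenteredGaussianLaw_sum c.support c

theorem integral_pow_four (hB : IsStdBrownian P F B) {t : ℝ} (ht : 0 ≤ t) :
    Integrable (fun ω => B t ω ^ 4) P ∧
      ∫ ω, B t ω ^ 4 ∂P = t ^ 2 * ∫ x, x ^ 4 ∂(gaussianReal 0 1) := by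
  have hlaw : P.map (B t) = (gaussianReal 0 1).map (fun x => √t * x) := by
    rw [hB.map_eq ht, gaussianReal_map_const_mul]
    congr 1
    · simp
    · ext
      simp [ht]
  have hm := hB.measurable t
  have hint : Integrable (fun x : ℝ => x ^ 4) (P.map (B t)) := by
    rw [hB.map_eq ht]
    have h := (memLp_id_gaussianReal (μ := 0) (v := t.toNNReal) 4).integrable_norm_pow'
    simpa [Even.pow_abs (n := 4) (by decide)] using h
  refine ⟨hint.comp_measurable hm, ?_⟩
  have h1 : ∫ ω, B t ω ^ 4 ∂P = ∫ x, x ^ 4 ∂(P.map (B t)) := by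
    rw [integral_map hm.aemeasurable (by fun_prop)]
  rw [h1, hlaw, integral_map (by fun_prop) (by fun_prop), ← integral_const_mul]
  congr 1
  ext x
  rw [mul_pow, show √t ^ 4 = (√t ^ 2) ^ 2 by ring, Real.sq_sqrt ht]

/-- Almost surely, the fourth power of a Brownian path is integrable against
`(1 + s) ^ (-7 / 2)`; this is the only growth bound on Brownian paths that is needed. -/
theorem ae_integrableOn_pow_four (hB : IsStdBrownian P F B) [IsProbabilityMeasure P] :
    ∀ᵐ ω ∂P, IntegrableOn (fun s => B s ω ^ 4 * (1 + s) ^ (-(7 / 2) : ℝ)) (Ioi 0) := by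
  have hBm : Measurable (Function.uncurry B) :=
    (stronglyMeasurable_uncurry_of_continuous_of_stronglyMeasurable hB.2.2.1
      fun t => (hB.measurable t).stronglyMeasurable).measurable
  have hfm : Measurable (Function.uncurry fun (s : ℝ) ω => B s ω ^ 4 * (1 + s) ^ (-(7 / 2) : ℝ)) :=
    (hBm.pow_const 4).mul (by fun_prop)
  set C := ∫ x, x ^ 4 ∂(gaussianReal 0 1) with hC
  have hC0 : 0 ≤ C := integral_nonneg fun x => by positivity
  have hprod : Integrable (Function.uncurry fun (s : ℝ) ω => B s ω ^ 4 * (1 + s) ^ (-(7 / 2) : ℝ))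
      ((volume.restrict (Ioi 0)).prod P) := by
    rw [integrable_prod_iff hfm.aestronglyMeasurable]
    constructor
    · filter_upwards [ae_restrict_mem measurableSet_Ioi] with s hs
      exact (hB.integral_pow_four (le_of_lt hs)).1.mul_const ((1 + s) ^ (-(7 / 2) : ℝ))
    · have hdom : IntegrableOn (fun s : ℝ => C * (s + 1) ^ (-(3 / 2) : ℝ)) (Ioi 0) :=
        (integrableOn_add_rpow_Ioi_of_lt (by norm_num) (by norm_num)).const_mul C
      refine Integrable.mono' hdom ?_ ?_
      · exact (hfm.norm.stronglyMeasurable.integral_prod_right).aestronglyMeasurable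
      · filter_upwards [ae_restrict_mem measurableSet_Ioi] with s hs
        have hs : (0:ℝ) < s := hs
        have h1 : ∀ ω, ‖Function.uncurry (fun (s : ℝ) ω => B s ω ^ 4 * (1 + s) ^ (-(7 / 2) : ℝ))
            (s, ω)‖ = B s ω ^ 4 * (1 + s) ^ (-(7 / 2) : ℝ) := fun ω => by
          rw [Function.uncurry_apply_pair, Real.norm_of_nonneg (by positivity)]
        simp_rw [h1]
        rw [integral_mul_const, (hB.integral_pow_four hs.le).2,
          Real.norm_of_nonneg (by positivity)]
        have h2 : (s + 1) ^ (-(3 / 2) : ℝ) = (1 + s) ^ 2 * (1 + s) ^ (-(7 / 2) : ℝ) := by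
          rw [← Real.rpow_natCast, ← Real.rpow_add (by positivity), add_comm]
          norm_num
        rw [h2]
        have : s ^ 2 * C ≤ (1 + s) ^ 2 * C := by gcongr; linarith
        have h3 : (0:ℝ) ≤ (1 + s) ^ (-(7 / 2) : ℝ) := by positivity
        nlinarith
  exact hprod.prod_left_ae

end IsStdBrownian

end GaussianClosure


/-- The time integral `∫_0^t U` of the Ornstein–Uhlenbeck path driven by `σ β`. -/
def ouIntegral (c σ : ℝ) (β : ℝ → ℝ) (t : ℝ) : ℝ :=
  Real.exp (-(c * t)) * (σ * ∫ s in (0:ℝ)..t, Real.exp (c * s) * β s)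

/-- The integral `∫_0^t e^{cs} U(s) ds` of the Ornstein–Uhlenbeck path driven by `σ β`,
expressed through `ouIntegral` by integration by parts. -/
def ouExpIntegral (c σ : ℝ) (β : ℝ → ℝ) (t : ℝ) : ℝ :=
  Real.exp (c * t) * ouIntegral c σ β t
    - c * ∫ s in (0:ℝ)..t, Real.exp (c * s) * ouIntegral c σ β s

/-- The part of `X(t) - U(t)` that is linear in the driving path `β`. -/
def noiseFunctional (c σ : ℝ) (β : ℝ → ℝ) (t : ℝ) : ℝ :=
  c * ∫ s in (0:ℝ)..t, Real.exp (-(c * s)) / (1 + s) * ouExpIntegral c σ β s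

section Pathwise

variable {c σ p q : ℝ} {β x u : ℝ → ℝ}

theorem hasDerivAt_integral {f : ℝ → ℝ} (hf : Continuous f) (t : ℝ) :
    HasDerivAt (fun t => ∫ s in (0:ℝ)..t, f s) (f t) t :=
  intervalIntegral.integral_hasDerivAt_right (hf.intervalIntegrable _ _)
    (hf.stronglyMeasurableAtFilter _ _) hf.continuousAt

theorem continuous_integral {f : ℝ → ℝ} (hf : Continuous f) :
    Continuous fun t => ∫ s in (0:ℝ)..t, f s :=
  continuous_iff_continuousAt.2 fun t => (hasDerivAt_integral hf t).continuousAt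

theorem continuous_ouIntegral (hβ : Continuous β) : Continuous (ouIntegral c σ β) := by
  have := continuous_integral (f := fun s => Real.exp (c * s) * β s) (by fun_prop)
  unfold ouIntegral
  fun_prop

theorem continuous_ouExpIntegral (hβ : Continuous β) : Continuous (ouExpIntegral c σ β) := by
  have h := continuous_ouIntegral (c := c) (σ := σ) hβ
  have := continuous_integral (f := fun s => Real.exp (c * s) * ouIntegral c σ β s) (by fun_prop)
  unfold ouExpIntegral
  fun_prop

theorem hasDerivAt_exp_const_mul (c t : ℝ) :
    HasDerivAt (fun t => Real.exp (c * t)) (c * Real.exp (c * t)) t := by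
  have := ((hasDerivAt_id t).const_mul c).exp
  simpa [mul_comm] using this

theorem integral_exp_const_mul (hc : 0 < c) (t : ℝ) :
    ∫ s in (0:ℝ)..t, Real.exp (c * s) = (Real.exp (c * t) - 1) / c := by
  rw [intervalIntegral.integral_comp_mul_left (fun x => Real.exp x) hc.ne', integral_exp]
  simp
  ring

/-- A bound `|f| ≤ K (1 + s) ^ r` with `r ≥ 0` is preserved, up to the factor `e^{ct} / c`,
by integration against `e^{cs}`. -/
theorem abs_integral_exp_mul_le {f : ℝ → ℝ} (hc : 0 < c) {K r : ℝ} (hr : 0 ≤ r)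
    (hf : ∀ s, 0 ≤ s → |f s| ≤ K * (1 + s) ^ r) {t : ℝ} (ht : 0 ≤ t) :
    |∫ s in (0:ℝ)..t, Real.exp (c * s) * f s| ≤ K / c * Real.exp (c * t) * (1 + t) ^ r := by
  have hK : 0 ≤ K := by
    have := (abs_nonneg _).trans (hf 0 le_rfl)
    simpa using this
  have h := intervalIntegral.norm_integral_le_of_norm_le (μ := volume) ht
    (f := fun s => Real.exp (c * s) * f s)
    (g := fun s => K * (1 + t) ^ r * Real.exp (c * s)) (by
      filter_upwards with s hs
      rw [Real.norm_eq_abs, abs_mul, Real.abs_exp, mul_comm]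
      gcongr
      refine (hf s hs.1.le).trans ?_
      have h0 := hs.1.le
      gcongr
      exact hs.2) (Continuous.intervalIntegrable (by fun_prop) _ _)
  rw [Real.norm_eq_abs, intervalIntegral.integral_const_mul, integral_exp_const_mul hc] at h
  refine h.trans ?_
  have : K * (1 + t) ^ r * ((Real.exp (c * t) - 1) / c)
      ≤ K * (1 + t) ^ r * (Real.exp (c * t) / c) := by
    gcongr
    linarith
  refine this.trans (le_of_eq ?_)
  ring

theorem exists_abs_ouIntegral_le (hc : 0 < c)
    (hint : IntegrableOn (fun s => β s ^ 4 * (1 + s) ^ (-(7 / 2) : ℝ)) (Ioi 0)) :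
    ∃ K, ∀ t, 0 ≤ t → |ouIntegral c σ β t| ≤ K * (1 + t) ^ (7 / 8 : ℝ) := by
  set f : ℝ → ℝ := fun s => β s ^ 4 * (1 + s) ^ (-(7 / 2) : ℝ) with hf
  have hf0 : ∀ s, 0 ≤ s → 0 ≤ f s := fun s hs => by positivity
  have hβf : ∀ s, 0 ≤ s → |β s| ≤ (1 + s) ^ (7 / 8 : ℝ) * (1 + f s) := by
    intro s hs
    set g : ℝ := (1 + s) ^ (7 / 8 : ℝ) with hg
    have hg0 : 0 < g := by positivity
    have hfg : f s = β s ^ 4 / g ^ 4 := by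
      rw [hg, ← Real.rpow_natCast ((1 + s) ^ (7 / 8 : ℝ)) 4, ← Real.rpow_mul (by positivity),
        div_eq_mul_inv, ← Real.rpow_neg (by positivity)]
      norm_num [hf]
    have hy : |β s| / g ≤ 1 + f s := by
      have h1 : f s = (|β s| / g) ^ 4 := by
        rw [hfg, div_pow, Even.pow_abs (by decide)]
      rw [h1]
      nlinarith [sq_nonneg ((|β s| / g) ^ 2 - 1), sq_nonneg (|β s| / g - 1)]
    rw [div_le_iff₀ hg0] at hy
    linarith
  have hfi : ∀ t, 0 ≤ t → IntervalIntegrable f volume 0 t := fun t ht => by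
    rw [intervalIntegrable_iff_integrableOn_Ioc_of_le ht]
    exact hint.mono_set Ioc_subset_Ioi_self
  refine ⟨|σ| * (1 / c + ∫ s in Ioi 0, f s), fun t ht => ?_⟩
  have hbd : |∫ s in (0:ℝ)..t, Real.exp (c * s) * β s|
      ≤ Real.exp (c * t) * (1 + t) ^ (7 / 8 : ℝ) * (1 / c + ∫ s in Ioi 0, f s) := by
    have hgi : IntervalIntegrable
        (fun s => Real.exp (c * s) + Real.exp (c * t) * f s) volume 0 t :=
      (Continuous.intervalIntegrable (by fun_prop) _ _).add ((hfi t ht).const_mul _)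
    have h := intervalIntegral.norm_integral_le_of_norm_le (μ := volume) ht
      (f := fun s => Real.exp (c * s) * β s)
      (g := fun s => (1 + t) ^ (7 / 8 : ℝ) * (Real.exp (c * s) + Real.exp (c * t) * f s)) (by
        filter_upwards with s hs
        have h0 := hs.1.le
        have hfs := hf0 s h0
        have hst := hs.2
        rw [Real.norm_eq_abs, abs_mul, Real.abs_exp]
        calc Real.exp (c * s) * |β s|
            ≤ Real.exp (c * s) * ((1 + t) ^ (7 / 8 : ℝ) * (1 + f s)) := by
              gcongr
              refine (hβf s h0).trans ?_
              gcongr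
          _ = (1 + t) ^ (7 / 8 : ℝ) * (Real.exp (c * s) + Real.exp (c * s) * f s) := by ring
          _ ≤ _ := by gcongr) (hgi.const_mul _)
    rw [Real.norm_eq_abs, intervalIntegral.integral_const_mul, intervalIntegral.integral_add
      (Continuous.intervalIntegrable (by fun_prop) _ _) ((hfi t ht).const_mul _),
      intervalIntegral.integral_const_mul, integral_exp_const_mul hc] at h
    have hF : ∫ s in (0:ℝ)..t, f s ≤ ∫ s in Ioi 0, f s := by
      rw [intervalIntegral.integral_of_le ht]
      refine setIntegral_mono_set hint ?_ (Ioc_subset_Ioi_self.eventuallyLE)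
      filter_upwards [ae_restrict_mem measurableSet_Ioi] with s hs using hf0 s (le_of_lt hs)
    refine h.trans ?_
    calc _ ≤ (1 + t) ^ (7 / 8 : ℝ) * (Real.exp (c * t) / c
          + Real.exp (c * t) * ∫ s in Ioi 0, f s) := by
          gcongr
          linarith
      _ = _ := by ring
  rw [ouIntegral, abs_mul, abs_mul, Real.abs_exp]
  calc _ ≤ Real.exp (-(c * t)) * (|σ| * (Real.exp (c * t) * (1 + t) ^ (7 / 8 : ℝ)
        * (1 / c + ∫ s in Ioi 0, f s))) := by gcongr
    _ = (Real.exp (-(c * t)) * Real.exp (c * t)) * (|σ| * (1 / c + ∫ s in Ioi 0, f s)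
        * (1 + t) ^ (7 / 8 : ℝ)) := by ring
    _ = _ := by rw [← Real.exp_add]; simp

theorem exists_abs_ouExpIntegral_le (hc : 0 < c) {K : ℝ}
    (hK : ∀ t, 0 ≤ t → |ouIntegral c σ β t| ≤ K * (1 + t) ^ (7 / 8 : ℝ)) {t : ℝ} (ht : 0 ≤ t) :
    |ouExpIntegral c σ β t| ≤ 2 * K * Real.exp (c * t) * (1 + t) ^ (7 / 8 : ℝ) := by
  have h1 := abs_integral_exp_mul_le hc (by norm_num) hK ht
  have h2 : |Real.exp (c * t) * ouIntegral c σ β t|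
      ≤ Real.exp (c * t) * (K * (1 + t) ^ (7 / 8 : ℝ)) := by
    rw [abs_mul, Real.abs_exp]
    gcongr
    exact hK t ht
  have h3 : |c * ∫ s in (0:ℝ)..t, Real.exp (c * s) * ouIntegral c σ β s|
      ≤ c * (K / c * Real.exp (c * t) * (1 + t) ^ (7 / 8 : ℝ)) := by
    rw [abs_mul, abs_of_pos hc]
    gcongr
  have h4 : c * (K / c * Real.exp (c * t) * (1 + t) ^ (7 / 8 : ℝ))
      = K * Real.exp (c * t) * (1 + t) ^ (7 / 8 : ℝ) := by field_simp
  refine (abs_sub _ _).trans ?_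
  linarith

/-- Solving the Ornstein–Uhlenbeck equation: the time integral of a solution. -/
theorem integral_eq_ouIntegral (hβ : Continuous β) (hu : Continuous u)
    (hu_eq : ∀ t, 0 ≤ t → u t = -c * (∫ s in (0:ℝ)..t, u s) + σ * β t) {t : ℝ} (ht : 0 ≤ t) :
    ∫ s in (0:ℝ)..t, u s = ouIntegral c σ β t := by
  have hcont := continuous_integral hu
  have h := intervalIntegral.integral_eq_sub_of_hasDerivAt_of_le ht
    (f := fun t => Real.exp (c * t) * ∫ s in (0:ℝ)..t, u s)
    (f' := fun t => σ * (Real.exp (c * t) * β t)) (by fun_prop) (fun s hs => by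
      refine ((hasDerivAt_exp_const_mul c s).mul (hasDerivAt_integral hu s)).congr_deriv ?_
      rw [hu_eq s hs.1.le]
      ring) (Continuous.intervalIntegrable (by fun_prop) _ _)
  rw [intervalIntegral.integral_const_mul] at h
  rw [ouIntegral, h]
  simp [← mul_assoc, ← Real.exp_add]

theorem integral_exp_mul_eq_ouExpIntegral (hβ : Continuous β) (hu : Continuous u)
    (hu_eq : ∀ t, 0 ≤ t → u t = -c * (∫ s in (0:ℝ)..t, u s) + σ * β t) {t : ℝ} (ht : 0 ≤ t) :
    ∫ s in (0:ℝ)..t, Real.exp (c * s) * u s = ouExpIntegral c σ β t := by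
  have hcont := continuous_integral hu
  have h := intervalIntegral.integral_eq_sub_of_hasDerivAt_of_le ht
    (f := fun t => Real.exp (c * t) * ∫ s in (0:ℝ)..t, u s)
    (f' := fun t => c * (Real.exp (c * t) * ∫ s in (0:ℝ)..t, u s) + Real.exp (c * t) * u t)
    (by fun_prop) (fun s hs => by
      refine ((hasDerivAt_exp_const_mul c s).mul (hasDerivAt_integral hu s)).congr_deriv ?_
      ring) (Continuous.intervalIntegrable (by fun_prop) _ _)
  rw [intervalIntegral.integral_add (Continuous.intervalIntegrable (by fun_prop) _ _)
    (Continuous.intervalIntegrable (by fun_prop) _ _), intervalIntegral.integral_const_mul] at h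
  have h2 : ∫ s in (0:ℝ)..t, Real.exp (c * s) * ∫ r in (0:ℝ)..s, u r
      = ∫ s in (0:ℝ)..t, Real.exp (c * s) * ouIntegral c σ β s := by
    refine intervalIntegral.integral_congr fun s hs => ?_
    rw [uIcc_of_le ht] at hs
    simp only [integral_eq_ouIntegral hβ hu hu_eq hs.1]
  rw [h2, integral_eq_ouIntegral hβ hu hu_eq ht] at h
  rw [ouExpIntegral]
  simp at h
  linarith

theorem integral_drift_eq (hx : Continuous x) (hu : Continuous u)
    (hx_eq : ∀ t, 0 ≤ t → x t = p
      + (∫ s in (0:ℝ)..t, (-c * x s + c / (1 + s) * (q + ∫ r in (0:ℝ)..s, x r))) + σ * β t)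
    (hu_eq : ∀ t, 0 ≤ t → u t = -c * (∫ s in (0:ℝ)..t, u s) + σ * β t) {t : ℝ} (ht : 0 ≤ t) :
    x t - u t = p + ∫ s in (0:ℝ)..t,
      -c * (x s - u s - (q + ∫ r in (0:ℝ)..s, x r) / (1 + |s|)) := by
  have hM := continuous_integral hx
  have hw : ∀ s : ℝ, 1 + |s| ≠ 0 := fun s => by positivity
  have h1 : ∫ s in (0:ℝ)..t, (-c * x s + c / (1 + s) * (q + ∫ r in (0:ℝ)..s, x r))
      = ∫ s in (0:ℝ)..t, (-c * x s + c / (1 + |s|) * (q + ∫ r in (0:ℝ)..s, x r)) := by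
    refine intervalIntegral.integral_congr fun s hs => ?_
    rw [uIcc_of_le ht] at hs
    simp only [abs_of_nonneg hs.1]
  rw [hx_eq t ht, hu_eq t ht, h1, ← intervalIntegral.integral_const_mul, add_sub_add_right_eq_sub,
    add_sub_assoc, ← intervalIntegral.integral_sub
      (Continuous.intervalIntegrable (by fun_prop (disch := exact hw _)) _ _)
      (Continuous.intervalIntegrable (by fun_prop) _ _)]
  congr 1
  refine intervalIntegral.integral_congr fun s _ => ?_
  ring

/-- The gap between `x - u` and the running average of `x` in closed form. -/
theorem sub_average_eq (hβ : Continuous β) (hx : Continuous x) (hu : Continuous u)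
    (hx_eq : ∀ t, 0 ≤ t → x t = p
      + (∫ s in (0:ℝ)..t, (-c * x s + c / (1 + s) * (q + ∫ r in (0:ℝ)..s, x r))) + σ * β t)
    (hu_eq : ∀ t, 0 ≤ t → u t = -c * (∫ s in (0:ℝ)..t, u s) + σ * β t) {t : ℝ} (ht : 0 ≤ t) :
    x t - u t - (q + ∫ s in (0:ℝ)..t, x s) / (1 + t)
      = Real.exp (-(c * t)) / (1 + t) * (p - q - ouExpIntegral c σ β t) := by
  have hM := continuous_integral hx
  have hw : ∀ s : ℝ, 1 + |s| ≠ 0 := fun s => by positivity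
  set g : ℝ → ℝ := fun s => -c * (x s - u s - (q + ∫ r in (0:ℝ)..s, x r) / (1 + |s|)) with hg
  have hgc : Continuous g := by fun_prop (disch := exact hw _)
  have hG := continuous_integral hgc
  have h := intervalIntegral.integral_eq_sub_of_hasDerivAt_of_le ht
    (f := fun t => Real.exp (c * t)
      * ((1 + t) * (p + ∫ s in (0:ℝ)..t, g s) - (q + ∫ s in (0:ℝ)..t, x s)))
    (f' := fun t => -(Real.exp (c * t) * u t))
    (by fun_prop) (fun s hs => by
      have h1 : HasDerivAt (fun t : ℝ => 1 + t) 1 s := (hasDerivAt_id s).const_add 1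
      refine ((hasDerivAt_exp_const_mul c s).mul ((h1.mul
        ((hasDerivAt_integral hgc s).const_add p)).sub
        ((hasDerivAt_integral hx s).const_add q))).congr_deriv ?_
      simp only [Pi.sub_apply, Pi.mul_apply]
      rw [← integral_drift_eq hx hu hx_eq hu_eq hs.1.le, hg]
      have : 1 + s ≠ 0 := by linarith [hs.1]
      simp only [abs_of_pos hs.1]
      field_simp
      ring) (Continuous.intervalIntegrable (by fun_prop) _ _)
  rw [intervalIntegral.integral_neg, integral_exp_mul_eq_ouExpIntegral hβ hu hu_eq ht,
    ← integral_drift_eq hx hu hx_eq hu_eq ht] at h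
  simp only [mul_zero, Real.exp_zero, intervalIntegral.integral_same, add_zero, one_mul] at h
  have h1 : 1 + t ≠ 0 := by positivity
  have h2 : p - q - ouExpIntegral c σ β t
      = Real.exp (c * t) * ((1 + t) * (x t - u t) - (q + ∫ s in (0:ℝ)..t, x s)) := by linarith
  rw [h2, div_mul_eq_mul_div, ← mul_assoc, ← Real.exp_add]
  simp
  field_simp

theorem sub_eq_add_noiseFunctional (hβ : Continuous β) (hx : Continuous x) (hu : Continuous u)
    (hx_eq : ∀ t, 0 ≤ t → x t = p
      + (∫ s in (0:ℝ)..t, (-c * x s + c / (1 + s) * (q + ∫ r in (0:ℝ)..s, x r))) + σ * β t)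
    (hu_eq : ∀ t, 0 ≤ t → u t = -c * (∫ s in (0:ℝ)..t, u s) + σ * β t) {t : ℝ} (ht : 0 ≤ t) :
    x t - u t = p - c * (p - q) * (∫ s in (0:ℝ)..t, Real.exp (-(c * s)) / (1 + s))
      + noiseFunctional c σ β t := by
  have hR := continuous_ouExpIntegral (c := c) (σ := σ) hβ
  have hw : ∀ s ∈ uIcc 0 t, 1 + s ≠ 0 := fun s hs => by
    rw [uIcc_of_le ht] at hs
    linarith [hs.1]
  have hi : ContinuousOn (fun s => Real.exp (-(c * s)) / (1 + s)) (uIcc 0 t) :=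
    ContinuousOn.div (by fun_prop) (by fun_prop) hw
  have hi₁ : IntervalIntegrable
      (fun s => c * (p - q) * (Real.exp (-(c * s)) / (1 + s))) volume 0 t :=
    (continuousOn_const.mul hi).intervalIntegrable
  have hi₂ : IntervalIntegrable
      (fun s => c * (Real.exp (-(c * s)) / (1 + s) * ouExpIntegral c σ β s)) volume 0 t :=
    (continuousOn_const.mul (hi.mul hR.continuousOn)).intervalIntegrable
  rw [integral_drift_eq hx hu hx_eq hu_eq ht, noiseFunctional,
    ← intervalIntegral.integral_const_mul, ← intervalIntegral.integral_const_mul, sub_add,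
    ← intervalIntegral.integral_sub hi₁ hi₂, sub_eq_add_neg,
    ← intervalIntegral.integral_neg]
  congr 1
  refine intervalIntegral.integral_congr fun s hs => ?_
  rw [uIcc_of_le ht] at hs
  rw [abs_of_nonneg hs.1, sub_average_eq hβ hx hu hx_eq hu_eq hs.1]
  ring

/-- Pathwise convergence of `x - u` and of the running average of `x` to a common limit. -/
theorem exists_tendsto_sub_and_average (hc : 0 < c) (hβ : Continuous β) (hx : Continuous x)
    (hu : Continuous u)
    (hint : IntegrableOn (fun s => β s ^ 4 * (1 + s) ^ (-(7 / 2) : ℝ)) (Ioi 0))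
    (hx_eq : ∀ t, 0 ≤ t → x t = p
      + (∫ s in (0:ℝ)..t, (-c * x s + c / (1 + s) * (q + ∫ r in (0:ℝ)..s, x r))) + σ * β t)
    (hu_eq : ∀ t, 0 ≤ t → u t = -c * (∫ s in (0:ℝ)..t, u s) + σ * β t) :
    ∃ l, Tendsto (fun t => x t - u t) atTop (nhds l) ∧
      Tendsto (fun t => 1 / (1 + t) * (q + ∫ s in (0:ℝ)..t, x s)) atTop (nhds l) := by
  obtain ⟨K, hK⟩ := exists_abs_ouIntegral_le (σ := σ) hc hint
  have hK0 : 0 ≤ K := by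
    have := (abs_nonneg _).trans (hK 0 le_rfl)
    simpa using this
  have hpow : ∀ t : ℝ, 0 ≤ t → (1 + t) ^ (7 / 8 : ℝ) / (1 + t) = (1 + t) ^ (-(1 / 8) : ℝ) := by
    intro t ht
    rw [div_eq_mul_inv, ← Real.rpow_neg_one, ← Real.rpow_add (by positivity)]
    norm_num
  have hpow' : ∀ t : ℝ, 0 ≤ t → (1 + t) ^ (-(1 / 8) : ℝ) / (1 + t) = (t + 1) ^ (-(9 / 8) : ℝ) := by
    intro t ht
    rw [div_eq_mul_inv, ← Real.rpow_neg_one, ← Real.rpow_add (by positivity), add_comm t]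
    norm_num
  set D : ℝ → ℝ := fun t => x t - u t - (q + ∫ s in (0:ℝ)..t, x s) / (1 + t) with hD
  have hDle : ∀ t, 0 ≤ t → |D t| ≤ (|p - q| + 2 * K) * (1 + t) ^ (-(1 / 8) : ℝ) := by
    intro t ht
    have hR := exists_abs_ouExpIntegral_le hc hK ht
    have h1 : 1 ≤ (1 + t) ^ (7 / 8 : ℝ) := Real.one_le_rpow (by linarith) (by norm_num)
    have h2 : 1 ≤ Real.exp (c * t) := Real.one_le_exp (by positivity)
    have hpq : |p - q| ≤ |p - q| * (Real.exp (c * t) * (1 + t) ^ (7 / 8 : ℝ)) :=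
      le_mul_of_one_le_right (abs_nonneg _) (one_le_mul_of_one_le_of_one_le h2 h1)
    rw [hD]
    simp only
    rw [sub_average_eq hβ hx hu hx_eq hu_eq ht, abs_mul, abs_of_nonneg (by positivity)]
    calc Real.exp (-(c * t)) / (1 + t) * |p - q - ouExpIntegral c σ β t|
        ≤ Real.exp (-(c * t)) / (1 + t) * ((|p - q| + 2 * K)
          * (Real.exp (c * t) * (1 + t) ^ (7 / 8 : ℝ))) := by
          gcongr
          refine (abs_sub _ _).trans ?_
          linarith
      _ = (Real.exp (-(c * t)) * Real.exp (c * t)) * ((|p - q| + 2 * K)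
          * ((1 + t) ^ (7 / 8 : ℝ) / (1 + t))) := by ring
      _ = _ := by rw [hpow t ht, ← Real.exp_add]; simp
  have hWle : ∀ t, 0 ≤ t → |(∫ s in (0:ℝ)..t, u s) / (1 + t)| ≤ K * (1 + t) ^ (-(1 / 8) : ℝ) := by
    intro t ht
    rw [integral_eq_ouIntegral hβ hu hu_eq ht, abs_div, abs_of_nonneg (by positivity : 0 ≤ 1 + t),
      ← hpow t ht, ← mul_div_assoc]
    gcongr
    exact hK t ht
  have hdecay : ∀ {f : ℝ → ℝ} {C : ℝ}, (∀ t, 0 ≤ t → |f t| ≤ C * (1 + t) ^ (-(1 / 8) : ℝ)) →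
      Tendsto f atTop (nhds 0) := by
    intro f C hf
    have h1 : Tendsto (fun t : ℝ => C * (1 + t) ^ (-(1 / 8) : ℝ)) atTop (nhds (C * 0)) :=
      ((tendsto_rpow_neg_atTop (by norm_num : (0:ℝ) < 1 / 8)).comp
        (tendsto_atTop_add_const_left atTop 1 tendsto_id)).const_mul C
    rw [mul_zero] at h1
    refine squeeze_zero_norm' ?_ h1
    filter_upwards [eventually_ge_atTop 0] with t ht using hf t ht
  have hderiv : ∀ t ∈ Ioi (0:ℝ), HasDerivAt
      (fun t => (q + (∫ s in (0:ℝ)..t, x s) - ∫ s in (0:ℝ)..t, u s) / (1 + t))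
      (D t / (1 + t) + (∫ s in (0:ℝ)..t, u s) / (1 + t) / (1 + t)) t := by
    intro t ht
    have h1 : HasDerivAt (fun t : ℝ => 1 + t) 1 t := (hasDerivAt_id t).const_add 1
    have h0 : 1 + t ≠ 0 := by linarith [mem_Ioi.1 ht]
    refine ((((hasDerivAt_integral hx t).const_add q).sub (hasDerivAt_integral hu t)).div
      h1 h0).congr_deriv ?_
    simp only [Pi.sub_apply, hD]
    field_simp
    ring
  have hM := continuous_integral hx
  have hW := continuous_integral hu
  have hne : ∀ t ∈ Ioi (0:ℝ), 1 + t ≠ 0 := fun t ht => by linarith [mem_Ioi.1 ht]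
  have hDc : ContinuousOn D (Ioi 0) :=
    (hx.sub hu).continuousOn.sub (ContinuousOn.div (by fun_prop) (by fun_prop) hne)
  have hintQ : IntegrableOn
      (fun t => D t / (1 + t) + (∫ s in (0:ℝ)..t, u s) / (1 + t) / (1 + t)) (Ioi 0) := by
    have hdom : IntegrableOn (fun t : ℝ => (|p - q| + 2 * K + K) * (t + 1) ^ (-(9 / 8) : ℝ))
        (Ioi 0) :=
      (integrableOn_add_rpow_Ioi_of_lt (by norm_num) (by norm_num)).const_mul _
    refine Integrable.mono' hdom ?_ ?_
    · refine ContinuousOn.aestronglyMeasurable ?_ measurableSet_Ioi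
      exact (hDc.div (by fun_prop) hne).add
        ((ContinuousOn.div hW.continuousOn (by fun_prop) hne).div (by fun_prop) hne)
    · filter_upwards [ae_restrict_mem measurableSet_Ioi] with t ht
      have ht0 : (0:ℝ) ≤ t := le_of_lt ht
      rw [Real.norm_eq_abs, ← add_div, abs_div, abs_of_nonneg (by positivity : 0 ≤ 1 + t),
        ← hpow' t ht0, ← mul_div_assoc]
      gcongr
      refine (abs_add_le _ _).trans ?_
      linarith [hDle t ht0, hWle t ht0]
  have hQ := tendsto_limUnder_of_hasDerivAt_of_integrableOn_Ioi hderiv hintQ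
  have hm := hQ.add (hdecay hWle)
  have hz := hm.add (hdecay hDle)
  simp only [add_zero] at hm hz
  refine ⟨_, hz.congr fun t => ?_, hm.congr fun t => ?_⟩
  · rw [hD]
    ring
  · ring

end Pathwise

theorem exists_tendsto_integral_exp_neg_div {c : ℝ} (hc : 0 < c) :
    ∃ l, Tendsto (fun t => ∫ s in (0:ℝ)..t, Real.exp (-(c * s)) / (1 + s)) atTop (nhds l) := by
  refine ⟨_, intervalIntegral_tendsto_integral_Ioi 0 ?_ tendsto_id⟩
  refine Integrable.mono' (exp_neg_integrableOn_Ioi 0 hc) ?_ ?_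
  · refine ContinuousOn.aestronglyMeasurable ?_ measurableSet_Ioi
    exact ContinuousOn.div (by fun_prop) (by fun_prop) fun t ht => by linarith [mem_Ioi.1 ht]
  · filter_upwards [ae_restrict_mem measurableSet_Ioi] with t ht
    have ht0 : (0:ℝ) < t := ht
    rw [Real.norm_eq_abs, abs_of_nonneg (by positivity), ← neg_mul]
    exact div_le_self (by positivity) (by linarith)

section NoiseFunctional

variable {Ω : Type*} {mΩ : MeasurableSpace Ω} {P : Measure Ω} {S : Submodule ℝ (Ω → ℝ)}
  {B : ℝ → Ω → ℝ}

theorem SeqAEClosure.ouIntegral (c σ : ℝ) (hB : ∀ ω, Continuous fun t => B t ω)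
    (hS : ∀ t, 0 ≤ t → SeqAEClosure P S (B t)) {t : ℝ} (ht : 0 ≤ t) :
    SeqAEClosure P S (fun ω => _root_.ouIntegral c σ (fun s => B s ω) t) :=
  ((SeqAEClosure.intervalIntegral ht
    (fun ω => (((by fun_prop : Continuous fun s : ℝ => Real.exp (c * s)).mul (hB ω)).continuousOn))
    fun s hs => (hS s hs).const_mul _).const_mul _).const_mul _

theorem SeqAEClosure.ouExpIntegral (c σ : ℝ) (hB : ∀ ω, Continuous fun t => B t ω)
    (hS : ∀ t, 0 ≤ t → SeqAEClosure P S (B t)) {t : ℝ} (ht : 0 ≤ t) :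
    SeqAEClosure P S (fun ω => _root_.ouExpIntegral c σ (fun s => B s ω) t) := by
  have h := ((SeqAEClosure.ouIntegral c σ hB hS ht).const_mul (Real.exp (c * t))).add
    ((SeqAEClosure.intervalIntegral ht (Y := fun s ω => Real.exp (c * s) *
      _root_.ouIntegral c σ (fun s => B s ω) s) (fun ω => Continuous.continuousOn (by
        have := continuous_ouIntegral (c := c) (σ := σ) (hB ω)
        fun_prop)) fun s hs => (SeqAEClosure.ouIntegral c σ hB hS hs).const_mul _).const_mul (-c))
  convert h using 2 with ω
  rw [_root_.ouExpIntegral]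
  ring

theorem SeqAEClosure.noiseFunctional (c σ : ℝ) (hB : ∀ ω, Continuous fun t => B t ω)
    (hS : ∀ t, 0 ≤ t → SeqAEClosure P S (B t)) {t : ℝ} (ht : 0 ≤ t) :
    SeqAEClosure P S (fun ω => _root_.noiseFunctional c σ (fun s => B s ω) t) :=
  (SeqAEClosure.intervalIntegral ht (fun ω =>
    (ContinuousOn.div (by fun_prop) (by fun_prop) fun s hs => by linarith [hs.1]).mul
      (continuous_ouExpIntegral (hB ω)).continuousOn)
    fun s hs => (SeqAEClosure.ouExpIntegral c σ hB hS hs).const_mul _).const_mul _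

theorem IsStdBrownian.hasCenteredGaussianLaw_of_tendsto_noiseFunctional
    [IsProbabilityMeasure P] {F : Filtration ℝ mΩ} (hB : IsStdBrownian P F B) (c σ : ℝ)
    {Z : Ω → ℝ} (hZ : ∀ᵐ ω ∂P, Tendsto (noiseFunctional c σ fun s => B s ω) atTop (nhds (Z ω))) :
    HasCenteredGaussianLaw P Z := by
  refine HasCenteredGaussianLaw.of_tendsto
    (Y := fun n ω => noiseFunctional c σ (fun s => B s ω) (n : ℝ)) (fun n => ?_)
    (hZ.mono fun ω hω => hω.comp tendsto_natCast_atTop_atTop)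
  refine SeqAEClosure.hasCenteredGaussianLaw
    (S := Submodule.span ℝ (range fun t : NNReal => B t))
    (fun Y hY => hB.hasCenteredGaussianLaw_of_mem_span hY)
    (SeqAEClosure.noiseFunctional c σ hB.2.2.1 (fun t ht => .of_mem ?_) n.cast_nonneg)
  exact Submodule.subset_span ⟨⟨t, ht⟩, rfl⟩

end NoiseFunctional

theorem continuous_comp_max_zero {f : ℝ → ℝ} (hf : ContinuousOn f (Ici 0)) :
    Continuous fun t => f (max t 0) :=
  hf.comp_continuous (by fun_prop) fun t => le_max_right t 0

theorem integral_comp_max_zero (f : ℝ → ℝ) {t : ℝ} (ht : 0 ≤ t) :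
    ∫ s in (0:ℝ)..t, f (max s 0) = ∫ s in (0:ℝ)..t, f s :=
  intervalIntegral.integral_congr fun s hs => by
    rw [uIcc_of_le ht] at hs
    simp only [max_eq_left hs.1]

theorem sfde_asymptotically_OU_plus_gaussian {Ω : Type*} {mΩ : MeasurableSpace Ω} (P : Measure Ω) [IsProbabilityMeasure P]
    (F : MeasureTheory.Filtration ℝ mΩ) (a b σ : ℝ) (ψ : ℝ → ℝ) (B X : ℝ → Ω → ℝ)
    (hσ : 0 < σ) (hψ : ContinuousOn ψ (Set.Icc (-1 : ℝ) 0))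
    (hB : IsStdBrownian P F B) (hX : IsSolutionSFDE P F a b σ ψ B X)
    (U : ℝ → Ω → ℝ) (hU : IsOUProcess P F a σ B U)
    (ha : a < 0) (hab : a + b = 0) :
    ∃ L : Ω → ℝ, Measurable L ∧ (∃ m : ℝ, ∃ v : NNReal, P.map L = gaussianReal m v) ∧
      ∀ᵐ ω ∂P,
        Filter.Tendsto (fun t : ℝ => X t ω - U t ω) Filter.atTop (nhds (L ω)) ∧
        Filter.Tendsto
          (fun t : ℝ => (1 / (1 + t)) * ((∫ u in (-1:ℝ)..(0:ℝ), ψ u) + ∫ s in (0:ℝ)..t, X s ω))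
          Filter.atTop (nhds (L ω)) := by
  obtain rfl : b = -a := by linarith
  obtain ⟨c, rfl⟩ : ∃ c, a = -c := ⟨-a, by simp⟩
  have hc : 0 < c := by linarith
  set q : ℝ := ∫ u in (-1:ℝ)..(0:ℝ), ψ u with hq
  have hpath : ∀ᵐ ω ∂P, (∃ l, Tendsto (fun t => X t ω - U t ω) atTop (nhds l) ∧
      Tendsto (fun t : ℝ => 1 / (1 + t) * (q + ∫ s in (0:ℝ)..t, X s ω)) atTop (nhds l)) ∧
      ∀ t, 0 ≤ t → X t ω - U t ω = ψ 0
        - c * (ψ 0 - q) * (∫ s in (0:ℝ)..t, Real.exp (-(c * s)) / (1 + s))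
        + noiseFunctional c σ (fun s => B s ω) t := by
    filter_upwards [hX.2.2, hU.2.2, hB.ae_integrableOn_pow_four] with ω hXω hUω hBω
    have hβ := hB.2.2.1 ω
    have hx := continuous_comp_max_zero (hX.2.1 ω)
    have hu := continuous_comp_max_zero (hU.2.1 ω)
    have hx_eq : ∀ t, 0 ≤ t → X (max t 0) ω = ψ 0 + (∫ s in (0:ℝ)..t,
        (-c * X (max s 0) ω + c / (1 + s) * (q + ∫ r in (0:ℝ)..s, X (max r 0) ω)))
        + σ * B t ω := by
      intro t ht
      rw [max_eq_left ht, hXω t ht]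
      congr 2
      refine intervalIntegral.integral_congr fun s hs => ?_
      rw [uIcc_of_le ht] at hs
      simp only [max_eq_left hs.1, integral_comp_max_zero (fun s => X s ω) hs.1, neg_neg, hq]
    have hu_eq : ∀ t, 0 ≤ t → U (max t 0) ω
        = -c * (∫ s in (0:ℝ)..t, U (max s 0) ω) + σ * B t ω := by
      intro t ht
      rw [max_eq_left ht, hUω t ht, integral_comp_max_zero (fun s => U s ω) ht]
    refine ⟨?_, fun t ht => ?_⟩
    · obtain ⟨l, h1, h2⟩ := exists_tendsto_sub_and_average hc hβ hx hu hBω hx_eq hu_eq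
      refine ⟨l, h1.congr' ?_, h2.congr' ?_⟩
      · filter_upwards [eventually_ge_atTop 0] with t ht
        rw [max_eq_left ht]
      · filter_upwards [eventually_ge_atTop 0] with t ht
        rw [integral_comp_max_zero (fun s => X s ω) ht]
    · have h := sub_eq_add_noiseFunctional hβ hx hu hx_eq hu_eq ht
      rwa [max_eq_left ht] at h
  have hmeas : ∀ n : ℕ, AEMeasurable (fun ω => X n ω - U n ω) P := fun n =>
    ((((hX.1 n n.cast_nonneg).mono (F.le n)).sub
      ((hU.1 n n.cast_nonneg).mono (F.le n))).measurable).aemeasurable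
  obtain ⟨L, hL, hLlim⟩ := measurable_limit_of_tendsto_metrizable_ae hmeas
    (hpath.mono fun ω ⟨⟨l, hl, _⟩, _⟩ => ⟨l, hl.comp tendsto_natCast_atTop_atTop⟩)
  have hlim : ∀ᵐ ω ∂P, Tendsto (fun t => X t ω - U t ω) atTop (nhds (L ω)) ∧
      Tendsto (fun t : ℝ => 1 / (1 + t) * (q + ∫ s in (0:ℝ)..t, X s ω)) atTop (nhds (L ω)) := by
    filter_upwards [hpath, hLlim] with ω ⟨⟨l, hl⟩, _⟩ hLω
    obtain rfl := tendsto_nhds_unique hLω (hl.1.comp tendsto_natCast_atTop_atTop)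
    exact hl
  obtain ⟨d, hd⟩ := exists_tendsto_integral_exp_neg_div hc
  have hZ : ∀ᵐ ω ∂P, Tendsto (noiseFunctional c σ fun s => B s ω) atTop
      (nhds (L ω - (ψ 0 - c * (ψ 0 - q) * d))) := by
    filter_upwards [hpath, hlim] with ω hω hLω
    refine (hLω.1.sub ((hd.const_mul (c * (ψ 0 - q))).const_sub (ψ 0))).congr' ?_
    filter_upwards [eventually_ge_atTop 0] with t ht
    rw [hω.2 t ht]
    ring
  obtain ⟨v, hv⟩ := hB.hasCenteredGaussianLaw_of_tendsto_noiseFunctional c σ hZ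
  refine ⟨L, hL, ⟨ψ 0 - c * (ψ 0 - q) * d, v, ?_⟩, hlim⟩
  have h := congrArg (Measure.map (· + (ψ 0 - c * (ψ 0 - q) * d))) hv
  rw [gaussianReal_map_add_const, Measure.map_map (by fun_prop) (by fun_prop), zero_add] at h
  rw [← h]
  congr 1
  ext ω
  simp
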